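/- arXiv:2505.11092 — 10 statements merged into one kernel-verified Lean document; each statement's English description precedes it below -/
import Mathlib

section
/- Let α, β, γ, δ, ℓ be natural numbers with α ≤ γ and β ≤ δ. Then the attractiveness condition (att1) holds for the jump rates of the discrete KMP model: ∑_{k' = ℓ+1+δ−β}^{α} 1/(α+β+1) ≤ ∑_{ℓ' = ℓ+1}^{γ} 1/(γ+δ+1), where both sums are over integer indices in the indicated ranges (an empty sum being 0) and the summands are real numbers. -/
/-- Attractiveness condition (att1) for the discrete KMP model. -/
theorem dKMP_att1 (α β γ δ ℓ : ℕ) (hαγ : α ≤ γ) (hβδ : β ≤ δ) :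
    ∑ k' ∈ Finset.Icc (ℓ + 1 + (δ - β)) α, (1 : ℝ) / ((α : ℝ) + β + 1)
      ≤ ∑ l' ∈ Finset.Icc (ℓ + 1) γ, (1 : ℝ) / ((γ : ℝ) + δ + 1) := by
  obtain ⟨e, rfl⟩ := Nat.exists_eq_add_of_le hαγ
  obtain ⟨d, rfl⟩ := Nat.exists_eq_add_of_le hβδ
  rw [Nat.add_sub_cancel_left]
  rcases le_total (ℓ + d) α with h | h
  · obtain ⟨m, rfl⟩ := Nat.exists_eq_add_of_le h
    have h₁ : ℓ + d + m + 1 - (ℓ + 1 + d) = m := by omega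
    have h₂ : ℓ + d + m + e + 1 - (ℓ + 1) = m + d + e := by omega
    rw [Finset.sum_const, Finset.sum_const, Nat.card_Icc, Nat.card_Icc, h₁, h₂,
      nsmul_eq_mul, nsmul_eq_mul, mul_one_div, mul_one_div,
      div_le_div_iff₀ (by positivity) (by positivity)]
    norm_cast
    nlinarith [Nat.zero_le ((d + e) * (ℓ + d + β + 1))]
  · rw [Finset.Icc_eq_empty (by omega), Finset.sum_empty]
    positivity
end

section
/- Let α, β, γ, δ, k be natural numbers with α ≤ γ and β ≤ δ. Then the attractiveness condition (att2) holds for the jump rates of the discrete KMP model: ∑_{k' = k+1}^{α} 1/(α+β+1) ≥ ∑_{ℓ' = γ−α+k+1}^{γ} 1/(γ+δ+1), where both sums are over integer indices in the indicated ranges (an empty sum being 0) and the summands are real numbers. -/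
/-- Attractiveness condition (att2) for the discrete KMP model. -/
theorem dKMP_att2 (α β γ δ k : ℕ) (hαγ : α ≤ γ) (hβδ : β ≤ δ) :
    ∑ k' ∈ Finset.Icc (k + 1) α, (1 : ℝ) / ((α : ℝ) + β + 1)
      ≥ ∑ l' ∈ Finset.Icc (γ - α + k + 1) γ, (1 : ℝ) / ((γ : ℝ) + δ + 1) := by
  have hcard : γ + 1 - (γ - α + k + 1) = α + 1 - (k + 1) := by omega
  simp only [Finset.sum_const, Nat.card_Icc, nsmul_eq_mul, hcard, ge_iff_le]
  gcongr
end

section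
/- Let s be a real number with 2s ≥ 1, and let α, β, γ, δ, ℓ be natural numbers with α ≤ γ and β ≤ δ. Then ∑_{k' = ℓ+1+δ−β}^{α} (1/k') · Γ(α+1)Γ(α−k'+2s) / (Γ(α+2s)Γ(α−k'+1)) ≤ ∑_{ℓ' = ℓ+1}^{γ} (1/ℓ') · Γ(γ+1)Γ(γ−ℓ'+2s) / (Γ(γ+2s)Γ(γ−ℓ'+1)), where Γ denotes the real Gamma function and empty sums are 0. -/
open Real

/-- The rate at which `k` particles leave a site occupied by `n` particles, with `t = 2s`. -/
noncomputable def harmonicRate (t : ℝ) (n k : ℕ) : ℝ :=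
  (1 / (k : ℝ)) * (Gamma ((n : ℝ) + 1) * Gamma ((n : ℝ) - (k : ℝ) + t))
    / (Gamma ((n : ℝ) + t) * Gamma ((n : ℝ) - (k : ℝ) + 1))

lemma harmonicRate_nonneg {t : ℝ} (ht : 0 < t) {n k : ℕ} (hk : k ≤ n) :
    0 ≤ harmonicRate t n k := by
  have hkn : (0 : ℝ) ≤ (n : ℝ) - k := sub_nonneg.2 (by exact_mod_cast hk)
  have h₁ : 0 < Gamma ((n : ℝ) + 1) := Gamma_pos_of_pos (by positivity)
  have h₂ : 0 < Gamma ((n : ℝ) - k + t) := Gamma_pos_of_pos (by linarith)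
  have h₃ : 0 < Gamma ((n : ℝ) + t) := Gamma_pos_of_pos (by positivity)
  have h₄ : 0 < Gamma ((n : ℝ) - k + 1) := Gamma_pos_of_pos (by linarith)
  unfold harmonicRate
  positivity

lemma harmonicRate_succ {t : ℝ} (ht : 0 < t) {n k : ℕ} (hk : k ≤ n) :
    harmonicRate t (n + 1) k = harmonicRate t n k *
      (((n : ℝ) + 1) * ((n : ℝ) - k + t) / (((n : ℝ) + t) * ((n : ℝ) - k + 1))) := by
  have hkn : (0 : ℝ) ≤ (n : ℝ) - k := sub_nonneg.2 (by exact_mod_cast hk)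
  have hn : (0 : ℝ) ≤ n := n.cast_nonneg
  have h₁ : Gamma ((n : ℝ) + 1 + 1) = ((n : ℝ) + 1) * Gamma ((n : ℝ) + 1) :=
    Gamma_add_one (by linarith)
  have h₂ : Gamma ((n : ℝ) + 1 - k + t) = ((n : ℝ) - k + t) * Gamma ((n : ℝ) - k + t) := by
    rw [← Gamma_add_one (by linarith)]
    ring_nf
  have h₃ : Gamma ((n : ℝ) + 1 + t) = ((n : ℝ) + t) * Gamma ((n : ℝ) + t) := by
    rw [← Gamma_add_one (by linarith)]
    ring_nf
  have h₄ : Gamma ((n : ℝ) + 1 - k + 1) = ((n : ℝ) - k + 1) * Gamma ((n : ℝ) - k + 1) := by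
    rw [← Gamma_add_one (by linarith)]
    ring_nf
  unfold harmonicRate
  push_cast
  rw [h₁, h₂, h₃, h₄, div_mul_div_comm]
  congr 1 <;> ring

lemma harmonicRate_le_succ {t : ℝ} (ht : 1 ≤ t) {n k : ℕ} (hk : k ≤ n) :
    harmonicRate t n k ≤ harmonicRate t (n + 1) k := by
  have hkn : (0 : ℝ) ≤ (n : ℝ) - k := sub_nonneg.2 (by exact_mod_cast hk)
  have hn : (0 : ℝ) ≤ n := n.cast_nonneg
  rw [harmonicRate_succ (by linarith) hk]
  refine le_mul_of_one_le_right (harmonicRate_nonneg (by linarith) hk) ?_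
  rw [one_le_div (mul_pos (by linarith) (by linarith))]
  nlinarith [mul_nonneg (sub_nonneg.2 ht) (k.cast_nonneg (α := ℝ))]

lemma harmonicRate_mono {t : ℝ} (ht : 1 ≤ t) {m n k : ℕ} (hk : k ≤ m) (hmn : m ≤ n) :
    harmonicRate t m k ≤ harmonicRate t n k := by
  induction n, hmn using Nat.le_induction with
  | base => exact le_rfl
  | succ n hmn ih => exact ih.trans (harmonicRate_le_succ ht (hk.trans hmn))

/-- Attractiveness condition (att1) for the Harmonic models with spin `s`, `2s ≥ 1`. -/
theorem harm_att1 (s : ℝ) (hs : 1 ≤ 2 * s) (α β γ δ ℓ : ℕ) (hαγ : α ≤ γ) (hβδ : β ≤ δ) :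
    ∑ k' ∈ Finset.Icc (ℓ + 1 + (δ - β)) α,
        (1 / (k' : ℝ)) * (Gamma ((α : ℝ) + 1) * Gamma ((α : ℝ) - (k' : ℝ) + 2 * s))
          / (Gamma ((α : ℝ) + 2 * s) * Gamma ((α : ℝ) - (k' : ℝ) + 1))
      ≤ ∑ l' ∈ Finset.Icc (ℓ + 1) γ,
        (1 / (l' : ℝ)) * (Gamma ((γ : ℝ) + 1) * Gamma ((γ : ℝ) - (l' : ℝ) + 2 * s))
          / (Gamma ((γ : ℝ) + 2 * s) * Gamma ((γ : ℝ) - (l' : ℝ) + 1)) := by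
  change ∑ k ∈ _, harmonicRate (2 * s) α k ≤ ∑ k ∈ _, harmonicRate (2 * s) γ k
  refine (Finset.sum_le_sum fun k hk =>
    harmonicRate_mono hs (Finset.mem_Icc.1 hk).2 hαγ).trans ?_
  exact Finset.sum_le_sum_of_subset_of_nonneg (Finset.Icc_subset_Icc (by omega) hαγ)
    fun k hk _ => harmonicRate_nonneg (by linarith) (Finset.mem_Icc.1 hk).2
end

section
/- Let s be a real number with 2s ≥ 1, and let α, β, γ, δ, k be natural numbers with α ≤ γ and β ≤ δ. Then ∑_{k' = k+1}^{α} (1/k') · Γ(α+1)Γ(α−k'+2s) / (Γ(α+2s)Γ(α−k'+1)) ≥ ∑_{ℓ' = γ−α+k+1}^{γ} (1/ℓ') · Γ(γ+1)Γ(γ−ℓ'+2s) / (Γ(γ+2s)Γ(γ−ℓ'+1)), where Γ denotes the real Gamma function and empty sums are 0. -/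
open Real

/-- For `1 ≤ m` the ratio `Γ(x + 1) / Γ(x + m)` does not increase when `x ≥ 0` is shifted by a
natural number. -/
theorem Gamma_add_one_div_Gamma_add_natCast_le {m x : ℝ} (hm : 1 ≤ m) (hx : 0 ≤ x) (d : ℕ) :
    Gamma (x + d + 1) / Gamma (x + d + m) ≤ Gamma (x + 1) / Gamma (x + m) := by
  induction d with
  | zero => simp
  | succ d ih =>
    refine le_trans ?_ ih
    have hm0 : 0 < x + d + m := by positivity
    have h1 : 0 < x + d + 1 := by positivity
    have e1 : x + (d + 1 : ℕ) + 1 = x + d + 1 + 1 := by push_cast; ring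
    have e2 : x + (d + 1 : ℕ) + m = x + d + m + 1 := by push_cast; ring
    rw [e1, e2, Gamma_add_one h1.ne', Gamma_add_one hm0.ne', mul_div_mul_comm]
    have hr : (x + d + 1) / (x + d + m) ≤ 1 := (div_le_one hm0).2 (by linarith)
    exact mul_le_of_le_one_left
      (div_nonneg (Gamma_pos_of_pos h1).le (Gamma_pos_of_pos hm0).le) hr

/-- Attractiveness condition (att2) for the Harmonic models with spin `s`, `2s ≥ 1`. -/
theorem harm_att2 (s : ℝ) (hs : 1 ≤ 2 * s) (α β γ δ k : ℕ) (hαγ : α ≤ γ) (hβδ : β ≤ δ) :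
    ∑ k' ∈ Finset.Icc (k + 1) α,
        (1 / (k' : ℝ)) * (Gamma ((α : ℝ) + 1) * Gamma ((α : ℝ) - (k' : ℝ) + 2 * s))
          / (Gamma ((α : ℝ) + 2 * s) * Gamma ((α : ℝ) - (k' : ℝ) + 1))
      ≥ ∑ l' ∈ Finset.Icc (γ - α + k + 1) γ,
        (1 / (l' : ℝ)) * (Gamma ((γ : ℝ) + 1) * Gamma ((γ : ℝ) - (l' : ℝ) + 2 * s))
          / (Gamma ((γ : ℝ) + 2 * s) * Gamma ((γ : ℝ) - (l' : ℝ) + 1)) := by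
  obtain ⟨d, rfl⟩ := Nat.exists_eq_add_of_le hαγ
  rw [Nat.add_sub_cancel_left, add_assoc d k 1, add_comm α d, ← Finset.map_add_left_Icc,
    Finset.sum_map]
  refine Finset.sum_le_sum fun j hj => ?_
  obtain ⟨hj1, hj2⟩ := Finset.mem_Icc.1 hj
  have hj0 : (0 : ℝ) < j := by exact_mod_cast (Nat.succ_pos k).trans_le hj1
  have hjα : (0 : ℝ) ≤ (α : ℝ) - j := sub_nonneg.2 (by exact_mod_cast hj2)
  have hsub : ((d + α : ℕ) : ℝ) - (addLeftEmbedding d j : ℕ) = α - j := by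
    simp
  have hadd : ((d + α : ℕ) : ℝ) = α + d := by push_cast; ring
  have hrec : 1 / ((addLeftEmbedding d j : ℕ) : ℝ) ≤ 1 / j :=
    one_div_le_one_div_of_le hj0 (by simp)
  have hratio := Gamma_add_one_div_Gamma_add_natCast_le hs (Nat.cast_nonneg α) d
  have hw : 0 ≤ Gamma ((α : ℝ) - j + 2 * s) / Gamma ((α : ℝ) - j + 1) :=
    div_nonneg (Gamma_pos_of_pos (by linarith)).le (Gamma_pos_of_pos (by linarith)).le
  rw [hsub, hadd, mul_div_assoc (1 / ((addLeftEmbedding d j : ℕ) : ℝ)),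
    mul_div_assoc (1 / (j : ℝ)), mul_div_mul_comm, mul_div_mul_comm]
  have hpos : 0 ≤ Gamma ((α : ℝ) + d + 1) / Gamma ((α : ℝ) + d + 2 * s) :=
    div_nonneg (Gamma_pos_of_pos (by positivity)).le (Gamma_pos_of_pos (by positivity)).le
  gcongr
end

section
/- Let s be a real number with 2s ≥ 1 and let k be a real number with k ≥ 0. Then the function φ(z) = Γ(z+1)Γ(z−k+2s) / (Γ(z+2s)Γ(z−k+1)) is nondecreasing on [k, ∞); that is, for all real numbers x, y with k ≤ x ≤ y, Γ(x+1)Γ(x−k+2s) / (Γ(x+2s)Γ(x−k+1)) ≤ Γ(y+1)Γ(y−k+2s) / (Γ(y+2s)Γ(y−k+1)), where Γ denotes the real Gamma function. -/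
open Real

open Filter Topology in
/-- If two quadruples of positive reals have the same sum, and the translates of one have the larger
product, then the Gamma function has the smaller product on that quadruple. -/
theorem Gamma_mul_le_Gamma_mul_of_forall_prod_le {a b c d a' b' c' d' : ℝ}
    (ha : 0 < a') (hb : 0 < b') (hc : 0 < c') (hd : 0 < d')
    (hsum : a + b + c + d = a' + b' + c' + d')
    (h : ∀ j : ℕ, (a' + j) * (b' + j) * ((c' + j) * (d' + j))
      ≤ (a + j) * (b + j) * ((c + j) * (d + j))) :
    Gamma a * Gamma b * (Gamma c * Gamma d) ≤ Gamma a' * Gamma b' * (Gamma c' * Gamma d') := by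
  have key (p q r t : ℝ) {n : ℕ} (hn : 0 < n) :
      GammaSeq p n * GammaSeq q n * (GammaSeq r n * GammaSeq t n)
        = (n : ℝ) ^ (p + q + r + t) * (n.factorial : ℝ) ^ 4
          / ∏ j ∈ Finset.range (n + 1), (p + j) * (q + j) * ((r + j) * (t + j)) := by
    have hn' : (0 : ℝ) < n := by exact_mod_cast hn
    simp only [GammaSeq, Finset.prod_mul_distrib, rpow_add hn', div_mul_div_comm]
    congr 1
    ring
  have lim (p q r t : ℝ) :
      Tendsto (fun n ↦ GammaSeq p n * GammaSeq q n * (GammaSeq r n * GammaSeq t n)) atTop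
        (𝓝 (Gamma p * Gamma q * (Gamma r * Gamma t))) :=
    ((GammaSeq_tendsto_Gamma p).mul (GammaSeq_tendsto_Gamma q)).mul
      ((GammaSeq_tendsto_Gamma r).mul (GammaSeq_tendsto_Gamma t))
  refine le_of_tendsto_of_tendsto (lim a b c d) (lim a' b' c' d') ?_
  filter_upwards [eventually_gt_atTop 0] with n hn
  rw [key a b c d hn, key a' b' c' d' hn, hsum]
  refine div_le_div_of_nonneg_left (by positivity) ?_ ?_
  · exact Finset.prod_pos fun j _ ↦ by positivity
  · exact Finset.prod_le_prod (fun j _ ↦ by positivity) fun j _ ↦ h j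

/-- The function `φ(z) = Γ(z+1)Γ(z−k+2s) / (Γ(z+2s)Γ(z−k+1))` is nondecreasing on `[k, ∞)`
when `2s ≥ 1` and `k ≥ 0`. -/
theorem harm_phi_monotone (s k : ℝ) (hs : 1 ≤ 2 * s) (hk : 0 ≤ k)
    (x y : ℝ) (hx : k ≤ x) (hxy : x ≤ y) :
    Gamma (x + 1) * Gamma (x - k + 2 * s) / (Gamma (x + 2 * s) * Gamma (x - k + 1))
      ≤ Gamma (y + 1) * Gamma (y - k + 2 * s) / (Gamma (y + 2 * s) * Gamma (y - k + 1)) := by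
  have hΓ (z : ℝ) (hz : k ≤ z) : 0 < Gamma (z + 2 * s) * Gamma (z - k + 1) :=
    mul_pos (Gamma_pos_of_pos (by linarith)) (Gamma_pos_of_pos (by linarith))
  rw [div_le_div_iff₀ (hΓ x hx) (hΓ y (hx.trans hxy))]
  refine Gamma_mul_le_Gamma_mul_of_forall_prod_le (by linarith) (by linarith) (by linarith)
    (by linarith) (by ring) fun j ↦ ?_
  have hj : (0 : ℝ) ≤ j := j.cast_nonneg
  have hdk : 0 ≤ (2 * s - 1) * k := mul_nonneg (by linarith) hk
  have hmono : (x + 1 + j) * (x - k + 2 * s + j) ≤ (y + 1 + j) * (y - k + 2 * s + j) :=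
    mul_le_mul (by linarith) (by linarith) (by linarith) (by linarith)
  linarith [mul_le_mul_of_nonneg_left hmono hdk]
end

section
/- Let a be a real number with a ≥ 1. Then the function f(z) = Γ(z+a)/Γ(z+1) is nondecreasing on [0, ∞); that is, for all real numbers x, y with 0 ≤ x ≤ y, Γ(x+a)/Γ(x+1) ≤ Γ(y+a)/Γ(y+1), where Γ denotes the real Gamma function. -/
open Real

/-- Two points lying between `p` and `t` with the same midpoint as `p` and `t` have a smaller
sum of values under a convex function. -/
theorem ConvexOn.add_le_add_of_add_eq_add {s : Set ℝ} {f : ℝ → ℝ} (hf : ConvexOn ℝ s f)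
    {p q r t : ℝ} (hp : p ∈ s) (ht : t ∈ s) (hpq : p ≤ q) (hqt : q ≤ t) (h : q + r = p + t) :
    f q + f r ≤ f p + f t := by
  obtain rfl : r = p + t - q := by linarith
  obtain ⟨α, β, hα, hβ, hαβ, rfl⟩ : q ∈ segment ℝ p t := by
    rw [segment_eq_Icc (hpq.trans hqt)]
    exact ⟨hpq, hqt⟩
  have h₁ := hf.2 hp ht hα hβ hαβ
  have h₂ := hf.2 hp ht hβ hα (by linarith)
  have hr : p + t - (α • p + β • t) = β • p + α • t := by
    obtain rfl : β = 1 - α := by linarith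
    simp only [smul_eq_mul]
    ring
  rw [hr]
  calc f (α • p + β • t) + f (β • p + α • t)
      ≤ (α • f p + β • f t) + (β • f p + α • f t) := add_le_add h₁ h₂
    _ = (α + β) * (f p + f t) := by simp only [smul_eq_mul]; ring
    _ = f p + f t := by rw [hαβ, one_mul]

/-- The function `f(z) = Γ(z+a)/Γ(z+1)` is nondecreasing on `[0, ∞)` when `a ≥ 1`. -/
theorem gamma_ratio_monotone (a : ℝ) (ha : 1 ≤ a) (x y : ℝ) (hx : 0 ≤ x) (hxy : x ≤ y) :
    Gamma (x + a) / Gamma (x + 1) ≤ Gamma (y + a) / Gamma (y + 1) := by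
  have hx1 : 0 < Gamma (x + 1) := Gamma_pos_of_pos (by linarith)
  have hy1 : 0 < Gamma (y + 1) := Gamma_pos_of_pos (by linarith)
  have hxa : 0 < Gamma (x + a) := Gamma_pos_of_pos (by linarith)
  have hya : 0 < Gamma (y + a) := Gamma_pos_of_pos (by linarith)
  have key := convexOn_log_Gamma.add_le_add_of_add_eq_add (p := x + 1) (q := x + a) (r := y + 1)
    (t := y + a) (Set.mem_Ioi.2 (by linarith)) (Set.mem_Ioi.2 (by linarith)) (by linarith)
    (by linarith) (by ring)
  simp only [Function.comp_apply] at key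
  rw [div_le_div_iff₀ hx1 hy1, ← log_le_log_iff (mul_pos hxa hy1) (mul_pos hya hx1),
    log_mul hxa.ne' hy1.ne', log_mul hya.ne' hx1.ne']
  linarith
end

section
/- Let s be a real number with 2s ≥ 1 and let k', α, γ be natural numbers with 1 ≤ k' and k' ≤ α ≤ γ. Then (1/k') · Γ(α+1)/Γ(α+2s) ≥ (1/(k' + γ − α)) · Γ(γ+1)/Γ(γ+2s), where Γ denotes the real Gamma function. -/
open Real

theorem antitone_Gamma_nat_add_one_div_Gamma_nat_add {t : ℝ} (ht : 1 ≤ t) :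
    Antitone fun n : ℕ => Gamma ((n : ℝ) + 1) / Gamma ((n : ℝ) + t) := by
  refine antitone_nat_of_succ_le fun n => ?_
  have hn : (0 : ℝ) ≤ n := n.cast_nonneg
  have hpos : 0 < (n : ℝ) + t := by linarith
  have hpos' : 0 < (n : ℝ) + 1 := by linarith
  have hG : 0 < Gamma ((n : ℝ) + 1) := Gamma_pos_of_pos hpos'
  have hGt : 0 < Gamma ((n : ℝ) + t) := Gamma_pos_of_pos hpos
  rw [Nat.cast_succ, Gamma_add_one hpos'.ne', add_right_comm (n : ℝ) 1 t,
    Gamma_add_one hpos.ne', mul_div_mul_comm]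
  refine mul_le_of_le_one_left (by positivity) ?_
  rw [div_le_one hpos]
  linarith

/-- Termwise inequality implying the second attractiveness inequality for the Harmonic model. -/
theorem harm_att2_termwise (s : ℝ) (hs : 1 ≤ 2 * s) (k' α γ : ℕ)
    (hk' : 1 ≤ k') (hk'α : k' ≤ α) (hαγ : α ≤ γ) :
    (1 / (k' : ℝ)) * (Gamma ((α : ℝ) + 1) / Gamma ((α : ℝ) + 2 * s))
      ≥ (1 / ((k' : ℝ) + (γ : ℝ) - (α : ℝ))) * (Gamma ((γ : ℝ) + 1) / Gamma ((γ : ℝ) + 2 * s)) := by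
  have hk : (0 : ℝ) < k' := by exact_mod_cast hk'
  have hle : (α : ℝ) ≤ γ := by exact_mod_cast hαγ
  have hγ : (0 : ℝ) ≤ γ := γ.cast_nonneg
  have hG : 0 < Gamma ((γ : ℝ) + 1) := Gamma_pos_of_pos (by linarith)
  have hGs : 0 < Gamma ((γ : ℝ) + 2 * s) := Gamma_pos_of_pos (by linarith)
  exact mul_le_mul (one_div_le_one_div_of_le hk (by linarith))
    (antitone_Gamma_nat_add_one_div_Gamma_nat_add hs hαγ) (by positivity) (by positivity)
end

section
/- For every natural number n and every real number a > 0, ∑_{k=1}^{n} k · Γ(n+1)Γ(a−k+n) / (Γ(a+n)Γ(n−k+1)) = (a+n)·n / (a·(a+1)), where Γ denotes the real Gamma function and the empty sum (n = 0) is 0. -/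
open Real

/-- A partial sum of the generating coefficients `Γ(a + j) / j!` against the weights `x - j`. -/
lemma sum_range_sub_mul_Gamma_div_factorial (a : ℝ) (ha : 0 < a) (x : ℝ) (m : ℕ) :
    ∑ j ∈ Finset.range m, (x - j) * (Gamma (a + j) / (j.factorial : ℝ))
      = Gamma (a + m) / (m.factorial : ℝ) * (m * (x / a - (m - 1) / (a + 1))) := by
  induction m with
  | zero => simp
  | succ m ih =>
    have ham : a + m ≠ 0 := by positivity
    have hfac : (m.factorial : ℝ) ≠ 0 := by positivity
    have hm : (m : ℝ) + 1 ≠ 0 := by positivity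
    have ha1 : a + 1 ≠ 0 := by positivity
    rw [Finset.sum_range_succ, ih, Nat.factorial_succ]
    push_cast
    rw [← add_assoc, Gamma_add_one ham]
    field_simp
    ring

/-- Identity \eqref{eq:harmonic_model_useful_identity2} for the Harmonic model. -/
theorem harm_identity2 (n : ℕ) (a : ℝ) (ha : 0 < a) :
    ∑ k ∈ Finset.Icc 1 n,
        (k : ℝ) * Gamma ((n : ℝ) + 1) * Gamma (a - (k : ℝ) + (n : ℝ))
          / (Gamma (a + (n : ℝ)) * Gamma ((n : ℝ) - (k : ℝ) + 1))
      = (a + (n : ℝ)) * (n : ℝ) / (a * (a + 1)) := by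
  have hG : Gamma (a + n) ≠ 0 := (Gamma_pos_of_pos (by positivity)).ne'
  have hfac : (n.factorial : ℝ) ≠ 0 := by positivity
  have ha1 : a + 1 ≠ 0 := by positivity
  have reflected : ∑ k ∈ Finset.Icc 1 n,
        (k : ℝ) * Gamma ((n : ℝ) + 1) * Gamma (a - (k : ℝ) + (n : ℝ))
          / (Gamma (a + (n : ℝ)) * Gamma ((n : ℝ) - (k : ℝ) + 1))
      = ∑ j ∈ Finset.range n, (n.factorial : ℝ) / Gamma (a + n) *
          (((n : ℝ) - j) * (Gamma (a + j) / (j.factorial : ℝ))) := by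
    refine Finset.sum_nbij' (fun k => n - k) (fun j => n - j) ?_ ?_ ?_ ?_ ?_
    · intro k hk
      simp only [Finset.mem_Icc, Finset.mem_range] at *
      omega
    · intro j hj
      simp only [Finset.mem_Icc, Finset.mem_range] at *
      omega
    · intro k hk
      simp only [Finset.mem_Icc] at *
      omega
    · intro j hj
      simp only [Finset.mem_range] at *
      omega
    · intro k hk
      have hkn : k ≤ n := (Finset.mem_Icc.mp hk).2
      rw [← Nat.cast_sub hkn, Gamma_nat_eq_factorial, Gamma_nat_eq_factorial,
        Nat.cast_sub hkn, show a - (k : ℝ) + n = a + (n - k) by ring]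
      field_simp
      ring
  rw [reflected, ← Finset.mul_sum, sum_range_sub_mul_Gamma_div_factorial a ha]
  field_simp
  ring
end

section
/- Let s > 0 be a real number and let a, b be natural numbers. Then (1/(2s))·(a−b)² − ∑_{k=1}^{a} [Γ(a+1)Γ(a−k+2s) / (Γ(a+2s)Γ(a−k+1))]·(a−b−k) − ∑_{k=1}^{b} [Γ(b+1)Γ(b−k+2s) / (Γ(b+2s)Γ(b−k+1))]·(b−a−k) = (1/(2s(2s+1)))·(a² + b² + 2s·a + 2s·b), where Γ denotes the real Gamma function and empty sums are 0. -/
open Real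

/-- The unnormalised stationary weights of the Harmonic model satisfy a telescoping
first-moment summation formula. -/
lemma sum_range_Gamma_div_mul_sub {t : ℝ} (ht : 0 < t) (c : ℝ) (n : ℕ) :
    ∑ m ∈ Finset.range n, Gamma (m + t) / Gamma (m + 1) * (m - c)
      = Gamma (n + t) / Gamma (n + 1) * (n * (n - 1) / (t + 1) - c * n / t) := by
  induction n with
  | zero => simp
  | succ n ih =>
    have h₁ : ((n + 1 : ℕ) : ℝ) + t = (n + t) + 1 := by push_cast; ring
    have h₂ : ((n + 1 : ℕ) : ℝ) + 1 = (n + 1 : ℝ) + 1 := by push_cast; ring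
    have hn : (n : ℝ) + 1 ≠ 0 := by positivity
    have hg : Gamma ((n : ℝ) + 1) ≠ 0 := (Gamma_pos_of_pos (by positivity)).ne'
    rw [Finset.sum_range_succ, ih, h₁, h₂, Gamma_add_one (by positivity : (n : ℝ) + t ≠ 0),
      Gamma_add_one hn]
    push_cast
    field_simp
    ring

/-- The mean of `n - k - c` under the jump rates of the Harmonic model from a site with
`n` particles, weighted by the jump size. -/
lemma sum_Icc_Gamma_mul_sub {t : ℝ} (ht : 0 < t) (c : ℝ) (n : ℕ) :
    ∑ k ∈ Finset.Icc 1 n,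
        (Gamma ((n : ℝ) + 1) * Gamma ((n : ℝ) - (k : ℝ) + t))
          / (Gamma ((n : ℝ) + t) * Gamma ((n : ℝ) - (k : ℝ) + 1))
          * ((n : ℝ) - c - (k : ℝ))
      = n * (n - 1) / (t + 1) - c * n / t := by
  have hg : Gamma ((n : ℝ) + 1) ≠ 0 := (Gamma_pos_of_pos (by positivity)).ne'
  have hgt : Gamma ((n : ℝ) + t) ≠ 0 := (Gamma_pos_of_pos (by positivity)).ne'
  calc
    _ = ∑ m ∈ Finset.range n, Gamma ((n : ℝ) + 1) / Gamma ((n : ℝ) + t)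
          * (Gamma (m + t) / Gamma (m + 1) * (m - c)) := by
      refine Finset.sum_nbij' (fun k => n - k) (fun m => n - m) ?_ ?_ ?_ ?_ ?_
      · intro k hk
        simp only [Finset.mem_Icc, Finset.mem_range] at *
        omega
      · intro m hm
        simp only [Finset.mem_Icc, Finset.mem_range] at *
        omega
      · intro k hk
        simp only [Finset.mem_Icc] at *
        omega
      · intro m hm
        simp only [Finset.mem_range] at *
        omega
      · intro k hk
        rw [Nat.cast_sub (Finset.mem_Icc.mp hk).2, mul_div_mul_comm]
        ring
    _ = _ := by
      rw [← Finset.mul_sum, sum_range_Gamma_div_mul_sub ht]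
      field_simp

/-- Carré du champ identity for the Harmonic model with spin `s > 0`. -/
theorem harm_carre_du_champ_identity (s : ℝ) (hs : 0 < s) (a b : ℕ) :
    (1 / (2 * s)) * ((a : ℝ) - b) ^ 2
        - (∑ k ∈ Finset.Icc 1 a,
            (Gamma ((a : ℝ) + 1) * Gamma ((a : ℝ) - (k : ℝ) + 2 * s))
              / (Gamma ((a : ℝ) + 2 * s) * Gamma ((a : ℝ) - (k : ℝ) + 1))
              * ((a : ℝ) - (b : ℝ) - (k : ℝ)))
        - (∑ k ∈ Finset.Icc 1 b,
            (Gamma ((b : ℝ) + 1) * Gamma ((b : ℝ) - (k : ℝ) + 2 * s))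
              / (Gamma ((b : ℝ) + 2 * s) * Gamma ((b : ℝ) - (k : ℝ) + 1))
              * ((b : ℝ) - (a : ℝ) - (k : ℝ)))
      = (1 / (2 * s * (2 * s + 1)))
          * ((a : ℝ) ^ 2 + (b : ℝ) ^ 2 + 2 * s * (a : ℝ) + 2 * s * (b : ℝ)) := by
  have ht : 0 < 2 * s := by positivity
  rw [sum_Icc_Gamma_mul_sub ht, sum_Icc_Gamma_mul_sub ht]
  field_simp
  ring
end

section
/- Let s be a real number with 2s ≥ 1 and let a, b be natural numbers. Then (1/(2s))·(a−b)² − ∑_{k=1}^{a} [Γ(a+1)Γ(a−k+2s) / (Γ(a+2s)Γ(a−k+1))]·(a−b−k) − ∑_{k=1}^{b} [Γ(b+1)Γ(b−k+2s) / (Γ(b+2s)Γ(b−k+1))]·(b−a−k) ≤ (1/(2s))·(a² + b²), where Γ denotes the real Gamma function and empty sums are 0. -/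
open Real

lemma sum_range_Gamma_ratio_mul_sub (t c : ℝ) (ht : 0 < t) (n : ℕ) :
    ∑ j ∈ Finset.range n, Gamma (j + t) / Gamma (j + 1) * ((j : ℝ) - c)
      = Gamma (n + t) / Gamma (n + 1) * (n * ((n - 1) / (t + 1) - c / t)) := by
  induction n with
  | zero => simp
  | succ n ih =>
    have hn : (0 : ℝ) < n + 1 := by positivity
    have hnt : (0 : ℝ) < n + t := by positivity
    have hG : Gamma ((n : ℝ) + 1) ≠ 0 := (Gamma_pos_of_pos hn).ne'
    have ht1 : t + 1 ≠ 0 := by positivity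
    rw [Finset.sum_range_succ, ih]
    push_cast
    rw [Gamma_add_one hn.ne', show (n : ℝ) + 1 + t = n + t + 1 by ring, Gamma_add_one hnt.ne']
    field_simp
    ring

lemma sum_harmonic_rate_mul_sub (t c : ℝ) (ht : 0 < t) (n : ℕ) :
    ∑ k ∈ Finset.Icc 1 n,
        (Gamma ((n : ℝ) + 1) * Gamma ((n : ℝ) - (k : ℝ) + t))
          / (Gamma ((n : ℝ) + t) * Gamma ((n : ℝ) - (k : ℝ) + 1))
          * ((n : ℝ) - c - (k : ℝ))
      = n * ((n - 1) / (t + 1) - c / t) := by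
  have hG : Gamma ((n : ℝ) + 1) ≠ 0 := (Gamma_pos_of_pos (by positivity)).ne'
  have hGt : Gamma ((n : ℝ) + t) ≠ 0 := (Gamma_pos_of_pos (by positivity)).ne'
  have reindex : ∑ k ∈ Finset.Icc 1 n,
        (Gamma ((n : ℝ) + 1) * Gamma ((n : ℝ) - (k : ℝ) + t))
          / (Gamma ((n : ℝ) + t) * Gamma ((n : ℝ) - (k : ℝ) + 1))
          * ((n : ℝ) - c - (k : ℝ))
      = ∑ j ∈ Finset.range n, Gamma ((n : ℝ) + 1) / Gamma ((n : ℝ) + t) *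
          (Gamma (j + t) / Gamma (j + 1) * ((j : ℝ) - c)) := by
    refine Finset.sum_nbij' (fun k => n - k) (fun j => n - j) ?_ ?_ ?_ ?_ ?_
    · intro k hk
      simp only [Finset.mem_Icc, Finset.mem_range] at *
      omega
    · intro j hj
      simp only [Finset.mem_Icc, Finset.mem_range] at *
      omega
    · intro k hk
      simp only [Finset.mem_Icc] at *
      omega
    · intro j hj
      simp only [Finset.mem_range] at *
      omega
    · intro k hk
      rw [Nat.cast_sub (Finset.mem_Icc.mp hk).2, mul_div_mul_comm]
      ring
  rw [reindex, ← Finset.mul_sum, sum_range_Gamma_ratio_mul_sub t c ht]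
  field_simp

lemma natCast_mul_sub_one_nonneg (n : ℕ) : (0 : ℝ) ≤ n * ((n : ℝ) - 1) := by
  cases n with
  | zero => simp
  | succ n =>
    push_cast
    rw [add_sub_cancel_right]
    positivity

/-- Key carré du champ bound for the Harmonic model with spin `s`, `2s ≥ 1`. -/
theorem harm_carre_du_champ_bound (s : ℝ) (hs : 1 ≤ 2 * s) (a b : ℕ) :
    (1 / (2 * s)) * ((a : ℝ) - b) ^ 2
        - (∑ k ∈ Finset.Icc 1 a,
            (Gamma ((a : ℝ) + 1) * Gamma ((a : ℝ) - (k : ℝ) + 2 * s))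
              / (Gamma ((a : ℝ) + 2 * s) * Gamma ((a : ℝ) - (k : ℝ) + 1))
              * ((a : ℝ) - (b : ℝ) - (k : ℝ)))
        - (∑ k ∈ Finset.Icc 1 b,
            (Gamma ((b : ℝ) + 1) * Gamma ((b : ℝ) - (k : ℝ) + 2 * s))
              / (Gamma ((b : ℝ) + 2 * s) * Gamma ((b : ℝ) - (k : ℝ) + 1))
              * ((b : ℝ) - (a : ℝ) - (k : ℝ)))
      ≤ (1 / (2 * s)) * ((a : ℝ) ^ 2 + (b : ℝ) ^ 2) := by
  have ht : 0 < 2 * s := by linarith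
  rw [sum_harmonic_rate_mul_sub (2 * s) b ht a, sum_harmonic_rate_mul_sub (2 * s) a ht b]
  have ha : 0 ≤ (a : ℝ) * (a - 1) / (2 * s + 1) :=
    div_nonneg (natCast_mul_sub_one_nonneg a) (by linarith)
  have hb : 0 ≤ (b : ℝ) * (b - 1) / (2 * s + 1) :=
    div_nonneg (natCast_mul_sub_one_nonneg b) (by linarith)
  have key : 1 / (2 * s) * ((a : ℝ) - b) ^ 2 - a * ((a - 1) / (2 * s + 1) - b / (2 * s))
      - b * ((b - 1) / (2 * s + 1) - a / (2 * s))
      = 1 / (2 * s) * ((a : ℝ) ^ 2 + b ^ 2) - a * (a - 1) / (2 * s + 1)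
        - b * (b - 1) / (2 * s + 1) := by
    ring
  linarith
end
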